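/- arXiv:1604.00566 — 7 statements merged into one kernel-verified Lean document; each statement's English description precedes it below -/
import Mathlib

section
/- Let d be a translation-invariant continuous metric on the circle 𝕋 = ℝ/2πℤ (i.e., d(x+z, y+z) = d(x,y) for all x,y,z), let α ∈ [1,∞), and let ν be the normalized Haar (uniform) probability measure on 𝕋. Then for every Borel probability measure μ on 𝕋, the generalized variance of μ is at most that of ν: inf over x ∈ 𝕋 of ∫ d(y,x)^α dμ(y) ≤ ∫ d(y,0)^α dν(y). That is, the equidistribution has the maximal variance among all probability measures, for every translation-invariant metric and every exponent. -/
open MeasureTheory Real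

instance : Fact (0 < 2 * Real.pi) := ⟨by positivity⟩

/-- On a compact group with probability measures `μ` and `ν`, `ν` right-invariant, the smallest
value of the average of the translates of a nonnegative continuous function with respect to `μ` is
at most its mean with respect to `ν`. -/
theorem iInf_integral_sub_le_integral {G : Type*} [AddGroup G] [TopologicalSpace G]
    [IsTopologicalAddGroup G] [CompactSpace G] [SecondCountableTopology G] [MeasurableSpace G]
    [BorelSpace G] (μ ν : Measure G) [IsProbabilityMeasure μ] [IsProbabilityMeasure ν]
    [ν.IsAddRightInvariant] {f : G → ℝ} (hf : Continuous f) (hf0 : ∀ x, 0 ≤ f x) :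
    ⨅ x, ∫ y, f (x - y) ∂μ ≤ ∫ x, f x ∂ν := by
  have hint : Integrable (Function.uncurry fun x y => f (x - y)) (ν.prod μ) :=
    (hf.comp continuous_sub).integrable_of_hasCompactSupport (HasCompactSupport.of_compactSpace _)
  have hbdd : BddBelow (Set.range fun x => ∫ y, f (x - y) ∂μ) :=
    ⟨0, by rintro _ ⟨x, rfl⟩; exact integral_nonneg fun y => hf0 _⟩
  calc ⨅ x, ∫ y, f (x - y) ∂μ
      = ∫ _, (⨅ x, ∫ y, f (x - y) ∂μ) ∂ν := by simp
    _ ≤ ∫ x, ∫ y, f (x - y) ∂μ ∂ν :=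
        integral_mono (integrable_const _) hint.integral_prod_left fun x => ciInf_le hbdd x
    _ = ∫ y, ∫ x, f (x - y) ∂ν ∂μ := integral_integral_swap hint
    _ = ∫ x, f x ∂ν := by simp [integral_sub_right_eq_self]

/-- For any translation-invariant continuous metric `d` on the circle `𝕋 = ℝ/2πℤ` and any
exponent `α ∈ [1,∞)`, the equidistribution (normalized Haar measure) has the maximal
generalized variance: for every Borel probability measure `μ` on `𝕋`,
`inf_x ∫ d(y,x)^α dμ(y) ≤ ∫ d(y,0)^α dν(y)` where `ν` is the uniform probability measure. -/
theorem equidistribution_has_maximal_variance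
    (d : AddCircle (2 * π) → AddCircle (2 * π) → ℝ)
    (hcont : Continuous (Function.uncurry d))
    (hsymm : ∀ x y, d x y = d y x)
    (hrefl : ∀ x, d x x = 0)
    (hsep : ∀ x y, d x y = 0 → x = y)
    (htriangle : ∀ x y z, d x z ≤ d x y + d y z)
    (hinv : ∀ x y z, d (x + z) (y + z) = d x y)
    (α : ℝ) (hα : 1 ≤ α)
    (μ : Measure (AddCircle (2 * π))) [IsProbabilityMeasure μ] :
    (⨅ x : AddCircle (2 * π), ∫ y, d y x ^ α ∂μ)
      ≤ ∫ y, d y 0 ^ α ∂(AddCircle.haarAddCircle : Measure (AddCircle (2 * π))) := by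
  have hnonneg : ∀ x y, 0 ≤ d x y := fun x y => by
    linarith [htriangle x y x, hrefl x, hsymm x y]
  have hcont0 : Continuous fun x => d x 0 ^ α :=
    (hcont.comp (Continuous.prodMk_left 0)).rpow_const
      fun _ => Or.inr (by linarith)
  have htranslate : ∀ x y, d y x = d (x - y) 0 := fun x y => by
    rw [hsymm, ← hinv (x - y) 0 y, sub_add_cancel, zero_add]
  have htranslate_iInf : (⨅ x, ∫ y, d y x ^ α ∂μ) = ⨅ x, ∫ y, d (x - y) 0 ^ α ∂μ :=
    iInf_congr fun x => integral_congr_ae (.of_forall fun y => by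
      simp only [htranslate x y])
  exact htranslate_iInf.trans_le <|
    iInf_integral_sub_le_integral μ AddCircle.haarAddCircle hcont0
      fun x => rpow_nonneg (hnonneg x 0) α
end

section
/- Let ψ ∈ L²([-π,π]) be a unit vector with Fourier coefficients ψ̂(n) = (2π)^{-1/2}∫_{-π}^{π} e^{-inθ}ψ(θ)dθ. Then for every a > 0: ∑_{n∈ℤ} n² |ψ̂(n)|² + (a² + 3a/π²) · ∫_{-π}^{π} θ² |ψ(θ)|² dθ ≥ a. (If the left-hand side series diverges the inequality holds trivially.) -/
open MeasureTheory Real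

/-- The Fourier coefficient of `f` on `[-π, π]` in the unitary normalization. -/
noncomputable def unitaryFourierCoeff (f : ℝ → ℂ) (n : ℤ) : ℂ :=
  (Real.sqrt (2 * π) : ℂ)⁻¹ * ∫ θ in (-π)..π, Complex.exp (-(n : ℂ) * θ * Complex.I) * f θ

/-- The trigonometric polynomial with unitary Fourier coefficients `b n` for `n ∈ s`. -/
noncomputable def trigPolynomial (s : Finset ℤ) (b : ℤ → ℂ) (θ : ℝ) : ℂ :=
  ∑ m ∈ s, (Real.sqrt (2 * π) : ℂ)⁻¹ * b m * Complex.exp (m * θ * Complex.I)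

lemma continuous_trigPolynomial (s : Finset ℤ) (b : ℤ → ℂ) : Continuous (trigPolynomial s b) := by
  unfold trigPolynomial
  fun_prop

lemma hasDerivAt_trigPolynomial (s : Finset ℤ) (b : ℤ → ℂ) (θ : ℝ) :
    HasDerivAt (trigPolynomial s b) (trigPolynomial s (fun m => m * Complex.I * b m) θ) θ := by
  unfold trigPolynomial
  refine HasDerivAt.fun_sum fun m _ => ?_
  have h1 : HasDerivAt (fun x : ℝ => (m : ℂ) * x * Complex.I) ((m : ℂ) * 1 * Complex.I) θ :=
    ((HasDerivAt.ofReal_comp (hasDerivAt_id θ)).const_mul (m : ℂ)).mul_const Complex.I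
  refine (h1.cexp.const_mul ((Real.sqrt (2 * π) : ℂ)⁻¹ * b m)).congr_deriv ?_
  ring

lemma sqrt_two_pi_mul_self : (Real.sqrt (2 * π) : ℂ) * Real.sqrt (2 * π) = 2 * π := by
  exact_mod_cast Real.mul_self_sqrt (by positivity : (0 : ℝ) ≤ 2 * π)

lemma sqrt_two_pi_ne_zero : (Real.sqrt (2 * π) : ℂ) ≠ 0 := by
  exact_mod_cast (Real.sqrt_pos.2 (by positivity : (0 : ℝ) < 2 * π)).ne'

lemma integral_exp_int_mul_I (k : ℤ) :
    ∫ θ in (-π)..π, Complex.exp (k * θ * Complex.I) = if k = 0 then 2 * (π : ℂ) else 0 := by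
  split_ifs with hk
  · simp [hk]
    ring
  · have hc : (k : ℂ) * Complex.I ≠ 0 := by simp [hk]
    have h := integral_exp_mul_complex (a := -π) (b := π) hc
    have he : Complex.exp (k * Complex.I * π) = Complex.exp (k * Complex.I * (-π : ℝ)) := by
      rw [Complex.exp_eq_exp_iff_exists_int]
      exact ⟨k, by push_cast; ring⟩
    rw [he, sub_self, zero_div] at h
    simpa only [mul_right_comm] using h

lemma unitaryFourierCoeff_trigPolynomial (s : Finset ℤ) (b : ℤ → ℂ) (n : ℤ) :
    unitaryFourierCoeff (trigPolynomial s b) n = if n ∈ s then b n else 0 := by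
  have h : ∀ θ : ℝ, Complex.exp (-(n : ℂ) * θ * Complex.I) * trigPolynomial s b θ
      = ∑ m ∈ s, (Real.sqrt (2 * π) : ℂ)⁻¹ * b m
          * Complex.exp (((m - n : ℤ) : ℂ) * θ * Complex.I) := by
    intro θ
    rw [trigPolynomial, Finset.mul_sum]
    refine Finset.sum_congr rfl fun m _ => ?_
    have : Complex.exp (((m - n : ℤ) : ℂ) * θ * Complex.I)
        = Complex.exp (-(n : ℂ) * θ * Complex.I) * Complex.exp (m * θ * Complex.I) := by
      rw [← Complex.exp_add]
      congr 1
      push_cast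
      ring
    rw [this]
    ring
  have hc := sqrt_two_pi_mul_self
  have hc0 := sqrt_two_pi_ne_zero
  rw [unitaryFourierCoeff]
  simp_rw [h]
  rw [intervalIntegral.integral_finsetSum
    (fun m _ => Continuous.intervalIntegrable (by fun_prop) _ _)]
  simp_rw [intervalIntegral.integral_const_mul, integral_exp_int_mul_I, sub_eq_zero, mul_ite,
    mul_zero]
  rw [Finset.sum_ite_eq']
  split_ifs with hn
  · rw [← hc]
    field_simp
  · simp

lemma memLp_trigPolynomial (s : Finset ℤ) (b : ℤ → ℂ) :
    MemLp (trigPolynomial s b) 2 (volume.restrict (Set.Ioc (-π) π)) := by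
  have hc := continuous_trigPolynomial s b
  rw [memLp_two_iff_integrable_sq_norm hc.aestronglyMeasurable]
  exact ((hc.norm.pow 2).intervalIntegrable (-π) π).1

lemma neg_pi_lt_pi : -π < π := by linarith [pi_pos]

lemma unitaryFourierCoeff_eq (f : ℝ → ℂ) (n : ℤ) :
    unitaryFourierCoeff f n = Real.sqrt (2 * π) * fourierCoeffOn neg_pi_lt_pi f n := by
  have hc := sqrt_two_pi_mul_self
  have hc0 := sqrt_two_pi_ne_zero
  have hpi : (π : ℂ) ≠ 0 := by exact_mod_cast pi_ne_zero
  have hint : ∫ x in (-π)..π, fourier (-n) (x : AddCircle (π - -π)) • f x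
      = ∫ θ in (-π)..π, Complex.exp (-(n : ℂ) * θ * Complex.I) * f θ := by
    congr! 2 with x
    rw [fourier_coe_apply, smul_eq_mul]
    congr 2
    push_cast
    field_simp
    ring
  rw [fourierCoeffOn_eq_integral, hint, unitaryFourierCoeff, Complex.real_smul]
  have : (((1 / (π - -π) : ℝ)) : ℂ) = (2 * (π : ℂ))⁻¹ := by
    push_cast
    rw [sub_neg_eq_add, ← two_mul, one_div]
  rw [this, ← hc, mul_inv, ← mul_assoc, mul_inv_cancel_left₀ hc0]

/-- Parseval's identity for the unitary Fourier coefficients. -/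
lemma hasSum_sq_unitaryFourierCoeff {f : ℝ → ℂ}
    (hf : MemLp f 2 (volume.restrict (Set.Ioc (-π) π))) :
    HasSum (fun n => ‖unitaryFourierCoeff f n‖ ^ 2) (∫ θ in (-π)..π, ‖f θ‖ ^ 2) := by
  have hcoeff : (fun n => ‖unitaryFourierCoeff f n‖ ^ 2)
      = fun n => 2 * π * ‖fourierCoeffOn neg_pi_lt_pi f n‖ ^ 2 := by
    funext n
    rw [unitaryFourierCoeff_eq, norm_mul, mul_pow, Complex.norm_real, norm_eq_abs, sq_abs,
      Real.sq_sqrt (by positivity)]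
  have hint : ∫ θ in (-π)..π, ‖f θ‖ ^ 2
      = 2 * π * ((π - -π)⁻¹ • ∫ θ in (-π)..π, ‖f θ‖ ^ 2) := by
    rw [smul_eq_mul, sub_neg_eq_add, ← two_mul, mul_inv_cancel_left₀ (by positivity)]
  rw [hcoeff, hint]
  exact (hasSum_sq_fourierCoeffOn neg_pi_lt_pi hf).mul_left (2 * π)

lemma integral_norm_sq_trigPolynomial (s : Finset ℤ) (b : ℤ → ℂ) :
    ∫ θ in (-π)..π, ‖trigPolynomial s b θ‖ ^ 2 = ∑ n ∈ s, ‖b n‖ ^ 2 := by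
  refine (hasSum_sq_unitaryFourierCoeff (memLp_trigPolynomial s b)).unique ?_
  have h := hasSum_sum_of_ne_finset_zero (s := s) (L := .unconditional ℤ)
    (f := fun n => ‖unitaryFourierCoeff (trigPolynomial s b) n‖ ^ 2) (fun n hn => by
      simp [unitaryFourierCoeff_trigPolynomial, hn])
  convert h using 1
  refine Finset.sum_congr rfl fun n hn => ?_
  rw [unitaryFourierCoeff_trigPolynomial, if_pos hn]

lemma unitaryFourierCoeff_sub {f g : ℝ → ℂ} (hf : IntervalIntegrable f volume (-π) π)
    (hg : IntervalIntegrable g volume (-π) π) (n : ℤ) :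
    unitaryFourierCoeff (f - g) n = unitaryFourierCoeff f n - unitaryFourierCoeff g n := by
  have he : ContinuousOn (fun θ : ℝ => Complex.exp (-(n : ℂ) * θ * Complex.I))
      (Set.uIcc (-π) π) := by fun_prop
  simp only [unitaryFourierCoeff, Pi.sub_apply, mul_sub]
  rw [intervalIntegral.integral_sub (hf.continuousOn_mul he) (hg.continuousOn_mul he), mul_sub]

/-- The squared `L²` distance of `f` from a partial sum of its Fourier series. -/
lemma integral_norm_sq_sub_trigPolynomial {f : ℝ → ℂ}
    (hf : MemLp f 2 (volume.restrict (Set.Ioc (-π) π))) (s : Finset ℤ) :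
    ∫ θ in (-π)..π, ‖f θ - trigPolynomial s (unitaryFourierCoeff f) θ‖ ^ 2
      = (∫ θ in (-π)..π, ‖f θ‖ ^ 2) - ∑ n ∈ s, ‖unitaryFourierCoeff f n‖ ^ 2 := by
  have hfi : IntervalIntegrable f volume (-π) π := by
    rw [intervalIntegrable_iff_integrableOn_Ioc_of_le neg_pi_lt_pi.le]
    exact hf.integrable one_le_two
  have h1 := hasSum_sq_unitaryFourierCoeff (hf.sub (memLp_trigPolynomial s (unitaryFourierCoeff f)))
  have h2 := hasSum_sum_of_ne_finset_zero (s := s) (L := .unconditional ℤ)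
    (f := fun n => if n ∈ s then ‖unitaryFourierCoeff f n‖ ^ 2 else 0) (fun n hn => if_neg hn)
  have h3 : ∑ n ∈ s, (if n ∈ s then ‖unitaryFourierCoeff f n‖ ^ 2 else 0)
      = ∑ n ∈ s, ‖unitaryFourierCoeff f n‖ ^ 2 :=
    Finset.sum_congr rfl fun n hn => if_pos hn
  rw [h3] at h2
  have h4 := (h1.add h2).unique (by
    convert hasSum_sq_unitaryFourierCoeff hf using 2 with n
    rw [unitaryFourierCoeff_sub hfi
      ((continuous_trigPolynomial s _).intervalIntegrable _ _),
      unitaryFourierCoeff_trigPolynomial]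
    split_ifs <;> simp)
  simp only [Pi.sub_apply] at h4
  linarith

/-- The differential form of the bound, by comparison with the logarithmic derivative
`-aθ(1 - θ²/π²)` of the trial function, which vanishes at `±π`. -/
lemma integral_norm_sq_deriv_add_nonneg {f f' : ℝ → ℂ} (hf : ∀ θ, HasDerivAt f (f' θ) θ)
    (hf' : Continuous f') {a : ℝ} (ha : 0 < a) :
    0 ≤ (∫ θ in (-π)..π, ‖f' θ‖ ^ 2)
      + ∫ θ in (-π)..π, ((a ^ 2 + 3 * a / π ^ 2) * θ ^ 2 - a) * ‖f θ‖ ^ 2 := by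
  have hfc : Continuous f := continuous_iff_continuousAt.2 fun θ => (hf θ).continuousAt
  set g : ℝ → ℝ := fun θ => -a * θ * (1 - θ ^ 2 / π ^ 2) with hg
  set g' : ℝ → ℝ := fun θ => -a + 3 * a / π ^ 2 * θ ^ 2 with hg'
  have hgd : ∀ θ, HasDerivAt g (g' θ) θ := by
    intro θ
    have h1 : HasDerivAt (fun x : ℝ => -a * x) (-a * 1) θ := (hasDerivAt_id θ).const_mul (-a)
    have h2 : HasDerivAt (fun x : ℝ => 1 - x ^ 2 / π ^ 2) (-(2 * θ / π ^ 2)) θ := by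
      simpa using ((hasDerivAt_pow 2 θ).div_const (π ^ 2)).const_sub 1
    refine (h1.mul h2).congr_deriv ?_
    rw [hg']
    ring
  have hgc : Continuous g := by fun_prop
  have hgc' : Continuous g' := by fun_prop
  set F : ℝ → ℝ := fun θ => g' θ * ‖f θ‖ ^ 2 + g θ * (2 * inner ℝ (f θ) (f' θ)) with hF
  have hFc : Continuous F := by fun_prop
  have hFint : ∫ θ in (-π)..π, F θ = 0 := by
    have hpi := pi_ne_zero
    rw [intervalIntegral.integral_eq_sub_of_hasDerivAt (f := fun θ => g θ * ‖f θ‖ ^ 2)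
      (fun θ _ => (hgd θ).mul (hf θ).norm_sq) (hFc.intervalIntegrable _ _)]
    simp [hg, hpi]
  have hle : ∀ θ ∈ Set.Icc (-π) π,
      F θ ≤ ‖f' θ‖ ^ 2 + ((a ^ 2 + 3 * a / π ^ 2) * θ ^ 2 - a) * ‖f θ‖ ^ 2 := by
    intro θ hθ
    have hq0 : 0 ≤ θ ^ 2 / π ^ 2 := by positivity
    have hq1 : θ ^ 2 / π ^ 2 ≤ 1 := by
      rw [div_le_one (by positivity)]
      exact sq_le_sq' hθ.1 hθ.2
    have hgle : g θ ^ 2 ≤ a ^ 2 * θ ^ 2 := by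
      have : (1 - θ ^ 2 / π ^ 2) ^ 2 ≤ 1 := by nlinarith
      calc g θ ^ 2 = a ^ 2 * θ ^ 2 * (1 - θ ^ 2 / π ^ 2) ^ 2 := by simp only [hg]; ring
        _ ≤ a ^ 2 * θ ^ 2 * 1 := by gcongr
        _ = _ := mul_one _
    have hsq := norm_sub_sq_real (f' θ) (g θ • f θ)
    rw [inner_smul_right, norm_smul, mul_pow, norm_eq_abs, sq_abs, real_inner_comm] at hsq
    have h0 := sq_nonneg ‖f' θ - g θ • f θ‖
    have h1 := mul_le_mul_of_nonneg_right hgle (sq_nonneg ‖f θ‖)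
    simp only [hF, hg']
    linarith
  rw [← intervalIntegral.integral_add (Continuous.intervalIntegrable (by fun_prop) _ _)
    (Continuous.intervalIntegrable (by fun_prop) _ _), ← hFint]
  exact intervalIntegral.integral_mono_on neg_pi_lt_pi.le (hFc.intervalIntegrable _ _)
    (Continuous.intervalIntegrable (by fun_prop) _ _) hle

lemma mul_norm_sq_le_add {E : Type*} [SeminormedAddCommGroup E] {w C ε : ℝ} (hε : 0 < ε)
    (hw : |w| ≤ C) (u v : E) :
    w * ‖u‖ ^ 2 ≤ w * ‖v‖ ^ 2 + C * ((1 + ε⁻¹) * ‖v - u‖ ^ 2 + ε * ‖v‖ ^ 2) := by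
  set x := ‖u‖
  set y := ‖v‖
  set d := ‖v - u‖
  have hd : |x - y| ≤ d := by
    rw [abs_sub_comm]
    exact abs_norm_sub_norm_le v u
  have hy : 0 ≤ y := norm_nonneg v
  have hd0 : 0 ≤ d := norm_nonneg _
  have hxy : x ^ 2 - y ^ 2 = (x - y) ^ 2 + 2 * (x - y) * y := by ring
  have hyoung : 2 * d * y ≤ ε⁻¹ * d ^ 2 + ε * y ^ 2 := by
    have h : 0 ≤ ε⁻¹ * (d - ε * y) ^ 2 := by positivity
    have he : ε⁻¹ * (d - ε * y) ^ 2 = ε⁻¹ * d ^ 2 + ε * y ^ 2 - 2 * d * y := by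
      field_simp
      ring
    linarith
  have habs : |x ^ 2 - y ^ 2| ≤ (1 + ε⁻¹) * d ^ 2 + ε * y ^ 2 := by
    have h2 : |x ^ 2 - y ^ 2| ≤ d ^ 2 + 2 * d * y := by
      rw [hxy]
      refine (abs_add_le _ _).trans ?_
      rw [abs_mul, abs_mul, abs_two, abs_of_nonneg hy, abs_pow]
      gcongr
    linarith
  have h := (le_abs_self (w * (x ^ 2 - y ^ 2))).trans_eq (abs_mul _ _)
  have h' := h.trans (mul_le_mul hw habs (abs_nonneg _) ((abs_nonneg w).trans hw))
  linarith

/-- The bound for a partial sum of the Fourier series, with the error terms. -/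
lemma sum_sq_mul_unitaryFourierCoeff_add_nonneg {f : ℝ → ℂ}
    (hf : MemLp f 2 (volume.restrict (Set.Ioc (-π) π))) {a : ℝ} (ha : 0 < a) (s : Finset ℤ)
    {ε : ℝ} (hε : 0 < ε) :
    0 ≤ (∑ n ∈ s, (n : ℝ) ^ 2 * ‖unitaryFourierCoeff f n‖ ^ 2)
      + (∫ θ in (-π)..π, ((a ^ 2 + 3 * a / π ^ 2) * θ ^ 2 - a) * ‖f θ‖ ^ 2)
      + ((a ^ 2 + 3 * a / π ^ 2) * π ^ 2 + a)
        * ((1 + ε⁻¹) * ((∫ θ in (-π)..π, ‖f θ‖ ^ 2) - ∑ n ∈ s, ‖unitaryFourierCoeff f n‖ ^ 2)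
          + ε * ∫ θ in (-π)..π, ‖f θ‖ ^ 2) := by
  set K := a ^ 2 + 3 * a / π ^ 2 with hK
  have hK0 : 0 ≤ K := by positivity
  set p := trigPolynomial s (unitaryFourierCoeff f) with hp
  have hpc : Continuous p := continuous_trigPolynomial s _
  have hmain := integral_norm_sq_deriv_add_nonneg
    (hasDerivAt_trigPolynomial s (unitaryFourierCoeff f)) (continuous_trigPolynomial s _) ha
  rw [integral_norm_sq_trigPolynomial] at hmain
  have hsum : ∑ n ∈ s, ‖(n : ℂ) * Complex.I * unitaryFourierCoeff f n‖ ^ 2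
      = ∑ n ∈ s, (n : ℝ) ^ 2 * ‖unitaryFourierCoeff f n‖ ^ 2 := by
    refine Finset.sum_congr rfl fun n _ => ?_
    rw [norm_mul, norm_mul, Complex.norm_I, mul_one, Complex.norm_intCast, mul_pow, sq_abs]
  rw [hsum] at hmain
  have hint : ∀ {h : ℝ → ℂ}, MemLp h 2 (volume.restrict (Set.Ioc (-π) π)) →
      IntervalIntegrable (fun θ => ‖h θ‖ ^ 2) volume (-π) π := fun hh => by
    rw [intervalIntegrable_iff_integrableOn_Ioc_of_le neg_pi_lt_pi.le]
    exact (memLp_two_iff_integrable_sq_norm hh.1).1 hh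
  have hf2 := hint hf
  have hd2 : IntervalIntegrable (fun θ => ‖f θ - p θ‖ ^ 2) volume (-π) π :=
    hint (hf.sub (memLp_trigPolynomial s _))
  have hWf : IntervalIntegrable (fun θ => (K * θ ^ 2 - a) * ‖f θ‖ ^ 2) volume (-π) π :=
    hf2.continuousOn_mul (by fun_prop)
  have herr := (((hd2.const_mul (1 + ε⁻¹)).add (hf2.const_mul ε)).const_mul (K * π ^ 2 + a))
  have hle : ∫ θ in (-π)..π, (K * θ ^ 2 - a) * ‖p θ‖ ^ 2
      ≤ ∫ θ in (-π)..π, ((K * θ ^ 2 - a) * ‖f θ‖ ^ 2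
        + (K * π ^ 2 + a) * ((1 + ε⁻¹) * ‖f θ - p θ‖ ^ 2 + ε * ‖f θ‖ ^ 2)) := by
    refine intervalIntegral.integral_mono_on neg_pi_lt_pi.le
      (Continuous.intervalIntegrable (by fun_prop) _ _) (hWf.add herr) fun θ hθ => ?_
    refine mul_norm_sq_le_add hε ?_ _ _
    have h1 : K * θ ^ 2 ≤ K * π ^ 2 := mul_le_mul_of_nonneg_left (sq_le_sq' hθ.1 hθ.2) hK0
    have h2 : 0 ≤ K * θ ^ 2 := by positivity
    rw [abs_le]
    constructor <;> linarith
  rw [intervalIntegral.integral_add hWf herr, intervalIntegral.integral_const_mul,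
    intervalIntegral.integral_add (hd2.const_mul _) (hf2.const_mul _),
    intervalIntegral.integral_const_mul, intervalIntegral.integral_const_mul,
    integral_norm_sq_sub_trigPolynomial hf] at hle
  linarith

/-- Family of linear uncertainty bounds for the pair (standard metric on ℤ, arc metric on 𝕋),
obtained from the trial function `φ(θ) = exp(−(a/2)θ²(1−θ²/(2π²)))`:
for every normalized `ψ ∈ L²([-π,π])` and every `a > 0`,
`∑_n n²|ψ̂(n)|² + (a² + 3a/π²)·∫ θ²|ψ(θ)|²dθ ≥ a`
(with the convention that a divergent series makes the left side infinite). -/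
theorem number_arc_linear_bound
    (ψ : ℝ → ℂ)
    (hmeas : AEStronglyMeasurable ψ (volume.restrict (Set.Ioc (-π) π)))
    (hnorm : (∫ θ in (-π)..π, ‖ψ θ‖ ^ 2) = 1)
    (ψhat : ℤ → ℂ)
    (hψhat : ∀ n : ℤ, ψhat n
      = (Real.sqrt (2 * π) : ℂ)⁻¹ * ∫ θ in (-π)..π, Complex.exp (-(n : ℂ) * θ * Complex.I) * ψ θ)
    (a : ℝ) (ha : 0 < a) :
    (∑' n : ℤ, ENNReal.ofReal ((n : ℝ) ^ 2 * ‖ψhat n‖ ^ 2))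
        + ENNReal.ofReal ((a ^ 2 + 3 * a / π ^ 2) * ∫ θ in (-π)..π, θ ^ 2 * ‖ψ θ‖ ^ 2)
      ≥ ENNReal.ofReal a := by
  obtain rfl : ψhat = unitaryFourierCoeff ψ := funext hψhat
  have hint : IntervalIntegrable (fun θ => ‖ψ θ‖ ^ 2) volume (-π) π := by
    by_contra h
    rw [intervalIntegral.integral_undef h] at hnorm
    exact zero_ne_one hnorm
  have hψ : MemLp ψ 2 (volume.restrict (Set.Ioc (-π) π)) :=
    (memLp_two_iff_integrable_sq_norm hmeas).2 hint.1
  by_cases hsum : Summable fun n : ℤ => (n : ℝ) ^ 2 * ‖unitaryFourierCoeff ψ n‖ ^ 2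
  swap
  · have htop : ∑' n : ℤ, ENNReal.ofReal ((n : ℝ) ^ 2 * ‖unitaryFourierCoeff ψ n‖ ^ 2) = ⊤ := by
      by_contra h
      refine hsum ((ENNReal.summable_toReal h).congr fun n => ?_)
      rw [ENNReal.toReal_ofReal (by positivity)]
    simp [htop]
  set K := a ^ 2 + 3 * a / π ^ 2 with hK
  have hW : ∫ θ in (-π)..π, (K * θ ^ 2 - a) * ‖ψ θ‖ ^ 2
      = K * (∫ θ in (-π)..π, θ ^ 2 * ‖ψ θ‖ ^ 2) - a := by
    have h2 : IntervalIntegrable (fun θ => θ ^ 2 * ‖ψ θ‖ ^ 2) volume (-π) π :=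
      hint.continuousOn_mul (by fun_prop)
    simp_rw [sub_mul, mul_assoc]
    rw [intervalIntegral.integral_sub (h2.const_mul K) (hint.const_mul a),
      intervalIntegral.integral_const_mul, intervalIntegral.integral_const_mul, hnorm, mul_one]
  have hparseval := hasSum_sq_unitaryFourierCoeff hψ
  rw [hnorm] at hparseval
  have hC : 0 < K * π ^ 2 + a := by positivity
  have key : ∀ ε : ℝ, 0 < ε →
      0 ≤ (∑' n : ℤ, (n : ℝ) ^ 2 * ‖unitaryFourierCoeff ψ n‖ ^ 2)
        + (K * (∫ θ in (-π)..π, θ ^ 2 * ‖ψ θ‖ ^ 2) - a)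
        + (K * π ^ 2 + a) * ((1 + ε⁻¹) * (1 - 1) + ε * 1) := by
    intro ε hε
    refine ge_of_tendsto' (x := Filter.atTop) ((hsum.hasSum.add_const _).add
      ((((hparseval.const_sub 1).const_mul (1 + ε⁻¹)).add_const (ε * 1)).const_mul
        (K * π ^ 2 + a))) fun s => ?_
    have h := sum_sq_mul_unitaryFourierCoeff_add_nonneg hψ ha s hε
    rw [hnorm, ← hK, hW] at h
    exact h
  have hfinal : a ≤ (∑' n : ℤ, (n : ℝ) ^ 2 * ‖unitaryFourierCoeff ψ n‖ ^ 2)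
      + K * ∫ θ in (-π)..π, θ ^ 2 * ‖ψ θ‖ ^ 2 := by
    refine le_of_forall_pos_le_add fun δ hδ => ?_
    have h := key (δ / (K * π ^ 2 + a)) (by positivity)
    rw [sub_self, mul_zero, zero_add, mul_one, mul_div_cancel₀ _ hC.ne'] at h
    linarith
  rw [← ENNReal.ofReal_tsum_of_nonneg (fun n => by positivity) hsum, ge_iff_le]
  exact (ENNReal.ofReal_le_ofReal hfinal).trans ENNReal.ofReal_add_le
end

section
/- Let ψ ∈ L²([-π,π]) be a unit vector with Fourier coefficients ψ̂(n) = (2π)^{-1/2}∫_{-π}^{π} e^{-inθ}ψ(θ)dθ. Then for every a > 0: ∑_{n∈ℤ} n² |ψ̂(n)|² + (a/2 + a²) · ∫_{-π}^{π} 2(1 − cos θ)|ψ(θ)|² dθ ≥ a. (If the left-hand side series diverges the inequality holds trivially.) -/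
open MeasureTheory Real

/-- **Parseval's identity** for the unitarily normalized Fourier coefficients on `(-π, π]`. -/
theorem hasSum_sq_norm_normalized_fourierCoeff {f : ℝ → ℂ}
    (hf : MemLp f 2 (volume.restrict (Set.Ioc (-π) π))) :
    HasSum (fun n : ℤ => ‖(Real.sqrt (2 * π) : ℂ)⁻¹ *
        ∫ θ in (-π)..π, Complex.exp (-(n : ℂ) * θ * Complex.I) * f θ‖ ^ 2)
      (∫ θ in (-π)..π, ‖f θ‖ ^ 2) := by
  have hπ : -π < π := by linarith [pi_pos]
  have h2π : (0 : ℝ) < 2 * π := by positivity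
  have hcoeff (n : ℤ) : fourierCoeffOn hπ f n = (2 * π : ℂ)⁻¹ *
      ∫ θ in (-π)..π, Complex.exp (-(n : ℂ) * θ * Complex.I) * f θ := by
    rw [fourierCoeffOn_eq_integral, Complex.real_smul]
    congr 1
    · push_cast
      ring
    · refine intervalIntegral.integral_congr fun θ _ => ?_
      simp only [fourier_coe_apply, smul_eq_mul]
      congr 2
      have : (π : ℂ) ≠ 0 := by exact_mod_cast pi_ne_zero
      push_cast
      field_simp
      ring
  have h := (hasSum_sq_fourierCoeffOn hπ hf).mul_left (2 * π)
  rw [smul_eq_mul, sub_neg_eq_add, ← two_mul, mul_inv_cancel_left₀ h2π.ne'] at h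
  refine (congrArg (HasSum · _) (funext fun n => ?_)).mpr h
  rw [hcoeff, norm_mul, norm_mul, mul_pow, mul_pow, ← mul_assoc]
  congr 1
  rw [norm_inv, norm_inv, Complex.norm_of_nonneg (Real.sqrt_nonneg _), inv_pow,
    Real.sq_sqrt h2π.le, show (2 * π : ℂ) = ((2 * π : ℝ) : ℂ) by push_cast; rfl,
    Complex.norm_of_nonneg h2π.le]
  field_simp

/-- The sequence-space form of the linear uncertainty bound: the second moment of a unit
vector `c` on `ℤ` against its nearest-neighbour difference energy. -/
theorem linear_bound_of_hasSum_sq_norm {c : ℤ → ℂ} {S V : ℝ} (a : ℝ)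
    (hc : HasSum (fun n => ‖c n‖ ^ 2) 1)
    (hS : HasSum (fun n : ℤ => (n : ℝ) ^ 2 * ‖c n‖ ^ 2) S)
    (hV : HasSum (fun n => ‖c n - c (n - 1)‖ ^ 2) V) :
    a ≤ S + (a / 2 + a ^ 2) * V := by
  -- Telescoping term coming from discrete integration by parts.
  let t : ℤ → ℝ := fun n => n * ((c n).re * (c (n + 1)).re + (c n).im * (c (n + 1)).im)
  have shift {f : ℤ → ℝ} {s : ℝ} (hf : HasSum f s) (k : ℤ) : HasSum (fun n => f (n + k)) s :=
    (Equiv.addRight k).hasSum_iff.mpr hf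
  have ht : Summable t := by
    refine Summable.of_norm_bounded (hS.summable.add (shift hc 1).summable) fun n => ?_
    simp only [Complex.sq_norm, Complex.normSq_apply, t, Real.norm_eq_abs]
    rw [abs_le]
    constructor <;>
    nlinarith [sq_nonneg (n * (c n).re + (c (n + 1)).re), sq_nonneg (n * (c n).im + (c (n + 1)).im),
      sq_nonneg (n * (c n).re - (c (n + 1)).re), sq_nonneg (n * (c n).im - (c (n + 1)).im),
      sq_nonneg (n * (c n).re), sq_nonneg (n * (c n).im), sq_nonneg (c (n + 1)).re,
      sq_nonneg (c (n + 1)).im]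
  have hsum := ((hS.sub (((shift ht.hasSum (-1)).sub ht.hasSum).mul_left a)).sub
    ((((shift hc (-1)).add hc).sub hV).mul_left (a / 2))).add
    ((hV.add (shift hV 1)).mul_left (a ^ 2 / 2))
  have hnonneg := hsum.nonneg fun n => by
    simp only [Complex.sq_norm, Complex.normSq_apply, t, Complex.sub_re, Complex.sub_im,
      ← sub_eq_add_neg, add_sub_cancel_right, sub_add_cancel]
    push_cast
    set x := (c n).re
    set y := (c n).im
    set p := (c (n - 1)).re
    set q := (c (n - 1)).im
    set u := (c (n + 1)).re
    set v := (c (n + 1)).im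
    linear_combination
      sq_nonneg (n * x - a / 2 * (p - u)) + sq_nonneg (n * y - a / 2 * (q - v))
        + (a ^ 2 / 4) * sq_nonneg ((p - x) - (x - u)) + (a ^ 2 / 4) * sq_nonneg ((q - y) - (y - v))
  linarith

/-- Family of linear uncertainty bounds for the pair (standard metric on ℤ, chordal metric on 𝕋),
obtained from the trial function `φ(θ) = exp(a cos θ)`: for every normalized `ψ ∈ L²([-π,π])`
and every `a > 0`, `∑_n n²|ψ̂(n)|² + (a/2 + a²)·∫ 2(1 − cos θ)|ψ(θ)|²dθ ≥ a`
(with the convention that a divergent series makes the left side infinite). -/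
theorem number_chordal_linear_bound
    (ψ : ℝ → ℂ)
    (hmeas : AEStronglyMeasurable ψ (volume.restrict (Set.Ioc (-π) π)))
    (hnorm : (∫ θ in (-π)..π, ‖ψ θ‖ ^ 2) = 1)
    (ψhat : ℤ → ℂ)
    (hψhat : ∀ n : ℤ, ψhat n
      = (Real.sqrt (2 * π) : ℂ)⁻¹ * ∫ θ in (-π)..π, Complex.exp (-(n : ℂ) * θ * Complex.I) * ψ θ)
    (a : ℝ) (ha : 0 < a) :
    (∑' n : ℤ, ENNReal.ofReal ((n : ℝ) ^ 2 * ‖ψhat n‖ ^ 2))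
        + ENNReal.ofReal ((a / 2 + a ^ 2) * ∫ θ in (-π)..π, 2 * (1 - Real.cos θ) * ‖ψ θ‖ ^ 2)
      ≥ ENNReal.ofReal a := by
  have hsq : Integrable (fun θ => ‖ψ θ‖ ^ 2) (volume.restrict (Set.Ioc (-π) π)) := by
    rw [intervalIntegral.integral_of_le (by linarith [pi_pos])] at hnorm
    exact not_imp_comm.mp integral_undef (by simp [hnorm])
  have hψ : MemLp ψ 2 (volume.restrict (Set.Ioc (-π) π)) :=
    (memLp_two_iff_integrable_sq_norm hmeas).mpr hsq
  have hexp (k : ℂ) : Continuous fun θ : ℝ => Complex.exp (k * θ * Complex.I) := by fun_prop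
  have hexp_norm (n : ℤ) (θ : ℝ) : ‖Complex.exp (-(n : ℂ) * θ * Complex.I)‖ = 1 := by
    simpa using Complex.norm_exp_ofReal_mul_I (-(n : ℝ) * θ)
  have hint (n : ℤ) : IntervalIntegrable
      (fun θ : ℝ => Complex.exp (-(n : ℂ) * θ * Complex.I) * ψ θ) volume (-π) π := by
    rw [intervalIntegrable_iff_integrableOn_Ioc_of_le (by linarith [pi_pos])]
    exact (hψ.integrable one_le_two).bdd_mul (hexp _).aestronglyMeasurable
      (Filter.Eventually.of_forall fun θ => (hexp_norm n θ).le)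
  have hχ : MemLp (fun θ : ℝ => (Complex.exp (-((-1 : ℤ) : ℂ) * θ * Complex.I)) * ψ θ) 2
      (volume.restrict (Set.Ioc (-π) π)) :=
    hψ.of_le ((hexp _).aestronglyMeasurable.mul hmeas)
      (Filter.Eventually.of_forall fun θ => by rw [norm_mul, hexp_norm, one_mul])
  have hc : HasSum (fun n => ‖ψhat n‖ ^ 2) 1 := by
    simpa only [← hψhat, hnorm] using hasSum_sq_norm_normalized_fourierCoeff hψ
  have hV : HasSum (fun n => ‖ψhat n - ψhat (n - 1)‖ ^ 2)
      (∫ θ in (-π)..π, 2 * (1 - Real.cos θ) * ‖ψ θ‖ ^ 2) := by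
    convert hasSum_sq_norm_normalized_fourierCoeff (hψ.sub hχ) using 1
    · ext n
      rw [hψhat, hψhat, ← mul_sub, ← intervalIntegral.integral_sub (hint _) (hint _)]
      congr 3
      refine intervalIntegral.integral_congr fun θ _ => ?_
      simp only [Pi.sub_apply]
      rw [mul_sub, ← mul_assoc, ← Complex.exp_add]
      congr 3
      push_cast
      ring
    · refine intervalIntegral.integral_congr fun θ _ => ?_
      simp only [Pi.sub_apply]
      rw [← one_sub_mul, norm_mul, mul_pow]
      congr 1
      have : -((-1 : ℤ) : ℂ) * θ * Complex.I = θ * Complex.I := by push_cast; ring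
      rw [this, Complex.sq_norm, Complex.normSq_apply]
      simp only [Complex.sub_re, Complex.sub_im, Complex.one_re, Complex.one_im,
        Complex.exp_ofReal_mul_I_re, Complex.exp_ofReal_mul_I_im]
      linear_combination -Real.sin_sq_add_cos_sq θ
  by_cases hS : Summable fun n : ℤ => (n : ℝ) ^ 2 * ‖ψhat n‖ ^ 2
  · have hV0 := hV.nonneg fun n => by positivity
    rw [← ENNReal.ofReal_tsum_of_nonneg (fun n => by positivity) hS,
      ← ENNReal.ofReal_add (tsum_nonneg fun n => by positivity) (by positivity)]
    exact ENNReal.ofReal_le_ofReal (linear_bound_of_hasSum_sq_norm a hc hS.hasSum hV)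
  · have htop : ∑' n : ℤ, ENNReal.ofReal ((n : ℝ) ^ 2 * ‖ψhat n‖ ^ 2) = ⊤ := by
      by_contra hne
      refine hS ((ENNReal.summable_toReal hne).congr fun n => ?_)
      exact ENNReal.toReal_ofReal (by positivity)
    simp [htop]
end

section
/- Chordal Judge relation: let ψ ∈ L²([-π,π]) be a unit vector with Fourier coefficients ψ̂(n) = (2π)^{-1/2}∫_{-π}^{π} e^{-inθ}ψ(θ)dθ. Define the number variance V_N(ψ) = inf over m ∈ ℤ of ∑_{n∈ℤ}(n−m)²|ψ̂(n)|² and the circular (chordal) variance V_cho(ψ) = 2(1 − |∫_{-π}^{π} e^{iθ}|ψ(θ)|² dθ|). Then √(V_N(ψ)) · √(V_cho(ψ)) ≥ (1 − V_cho(ψ)/2)/2. Equivalently, V_N(ψ) ≥ (2 − V_cho(ψ))²/(16·V_cho(ψ)) whenever V_cho(ψ) > 0. -/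
open MeasureTheory Real
open scoped ENNReal

/-- If `x` stands for `T p`, and `y` for `T⁻¹ p`, with `T` unitary, this is the pointwise form of
`0 ≤ ‖(k + (T - T⁻¹) / 2) p‖²`, up to the parallelogram law. -/
lemma quadratic_form_nonneg (k : ℝ) (p x y : ℂ) :
    0 ≤ k ^ 2 * ‖p‖ ^ 2
      + k * ((‖p‖ ^ 2 + ‖x‖ ^ 2 - ‖x - p‖ ^ 2) / 2 - (‖y‖ ^ 2 + ‖p‖ ^ 2 - ‖y - p‖ ^ 2) / 2)
      + (‖x - p‖ ^ 2 / 2 + ‖y - p‖ ^ 2 / 2) := by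
  simp only [Complex.sq_norm, Complex.normSq_apply, Complex.sub_re, Complex.sub_im]
  nlinarith [sq_nonneg (k * p.re + (x.re - y.re) / 2), sq_nonneg (k * p.im + (x.im - y.im) / 2),
    sq_nonneg (x.re + y.re - 2 * p.re), sq_nonneg (x.im + y.im - 2 * p.im)]

lemma abs_mul_polarization_le (k : ℝ) (p x : ℂ) :
    |k * ((‖p‖ ^ 2 + ‖x‖ ^ 2 - ‖x - p‖ ^ 2) / 2)| ≤ (k ^ 2 * ‖p‖ ^ 2 + ‖x‖ ^ 2) / 2 := by
  simp only [Complex.sq_norm, Complex.normSq_apply, Complex.sub_re, Complex.sub_im]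
  rw [abs_le]
  constructor
  · nlinarith [sq_nonneg (x.re + k * p.re), sq_nonneg (x.im + k * p.im)]
  · nlinarith [sq_nonneg (x.re - k * p.re), sq_nonneg (x.im - k * p.im)]

/-- Discrete uncertainty relation between position and translation in `ℓ²(ℤ)`. -/
lemma sq_le_variance_mul_shift_defect {a : ℤ → ℂ} {u : ℂ} (hu : ‖u‖ = 1) {V W : ℝ} (m : ℤ)
    (ha : HasSum (fun n => ‖a n‖ ^ 2) 1)
    (hW : HasSum (fun n => ‖u * a (n - 1) - a n‖ ^ 2) W)
    (hV : HasSum (fun n : ℤ => ((n : ℝ) - m) ^ 2 * ‖a n‖ ^ 2) V) :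
    (1 - W / 2) ^ 2 ≤ 4 * (V * W) := by
  set t : ℤ → ℝ := fun n => (‖a n‖ ^ 2 + ‖u * a (n - 1)‖ ^ 2 - ‖u * a (n - 1) - a n‖ ^ 2) / 2
    with ht
  have ha' : HasSum (fun n => ‖u * a (n - 1)‖ ^ 2) 1 := by
    simpa [hu, Function.comp_def] using (Equiv.subRight (1 : ℤ)).hasSum_iff.mpr ha
  have shift {f : ℤ → ℝ} {s : ℝ} (hf : HasSum f s) : HasSum (fun n => f (n + 1)) s :=
    (Equiv.addRight (1 : ℤ)).hasSum_iff.mpr hf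
  have htsum : HasSum t (1 - W / 2) := by
    convert! ((ha.add ha').sub hW).div_const 2 using 1
    ring
  have hsummable : Summable fun n : ℤ => ((n : ℝ) - m) * t n :=
    .of_norm_bounded ((hV.add ha').div_const 2).summable
      fun n => abs_mul_polarization_le _ _ _
  have hcomm : HasSum (fun n : ℤ => ((n : ℝ) - m) * (t n - t (n + 1))) (1 - W / 2) := by
    convert! hsummable.hasSum.sub ((shift hsummable.hasSum).sub (shift htsum)) using 1
    · ext n
      push_cast
      ring
    · ring
  have hquad : ∀ l : ℝ, 0 ≤ V * (l * l) + (1 - W / 2) * l + W := fun l => by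
    have hsum := ((hV.mul_left (l ^ 2)).add (hcomm.mul_left l)).add
      ((hW.div_const 2).add ((shift hW).div_const 2))
    convert! hsum.nonneg fun n => ?_ using 1
    · ring
    · have hu0 : u ≠ 0 := norm_ne_zero_iff.mp (by simp [hu])
      have key := quadratic_form_nonneg (l * ((n : ℝ) - m)) (a n) (u * a (n - 1)) (u⁻¹ * a (n + 1))
      have h1 : ‖u⁻¹ * a (n + 1)‖ = ‖a (n + 1)‖ := by simp [hu]
      have h2 : ‖u⁻¹ * a (n + 1) - a n‖ = ‖u * a n - a (n + 1)‖ := by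
        rw [norm_sub_rev (u * a n), ← one_mul ‖u⁻¹ * a (n + 1) - a n‖, ← hu, ← norm_mul, mul_sub,
          mul_inv_cancel_left₀ hu0]
      have h3 : ‖u * a n‖ = ‖a n‖ := by simp [hu]
      rw [h1, h2] at key
      simp only [ht, add_sub_cancel_right, h3]
      linarith
  have := discrim_le_zero hquad
  rw [discrim] at this
  linarith

/-- No normalized element of `ℓ²(ℤ)` is an eigenvector of the translation. -/
lemma shift_defect_pos {a : ℤ → ℂ} {u : ℂ} (hu : ‖u‖ = 1) {W : ℝ}
    (ha : HasSum (fun n => ‖a n‖ ^ 2) 1)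
    (hW : HasSum (fun n => ‖u * a (n - 1) - a n‖ ^ 2) W) : 0 < W := by
  refine (hW.nonneg fun n => by positivity).lt_of_ne' fun h => ?_
  subst h
  have hzero := (hasSum_zero_iff_of_nonneg fun n => by positivity).mp hW
  have hstep (n : ℤ) : ‖a (n + 1)‖ = ‖a n‖ := by
    have h := congrFun hzero (n + 1)
    simp only [add_sub_cancel_right, Pi.zero_apply, sq_eq_zero_iff, norm_eq_zero] at h
    rw [← sub_eq_zero.mp h, norm_mul, hu, one_mul]
  have hconst (n : ℤ) : ‖a n‖ = ‖a 0‖ := by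
    induction n with
    | zero => rfl
    | succ n ih => rw [hstep, ih]
    | pred n ih => rw [← ih, ← hstep, sub_add_cancel]
  simp only [hconst] at ha
  have := (summable_const_iff _).mp ha.summable
  rw [this] at ha
  exact zero_ne_one (hasSum_zero.unique ha)

/-- Parseval's identity on `[-π, π]`. -/
lemma hasSum_sq_norm_fourierIntegral {f : ℝ → ℂ}
    (hf : MemLp f 2 (volume.restrict (Set.Ioc (-π) π))) :
    HasSum (fun n : ℤ => ‖(√(2 * π) : ℂ)⁻¹
        * ∫ θ in (-π)..π, Complex.exp (-(n : ℂ) * θ * Complex.I) * f θ‖ ^ 2)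
      (∫ θ in (-π)..π, ‖f θ‖ ^ 2) := by
  have hπ : -π < π := by linarith [pi_pos]
  have hlen : π - -π = 2 * π := by ring
  have hpos : 0 < 2 * π := by positivity
  convert! (hasSum_sq_fourierCoeffOn hπ hf).mul_left (2 * π) using 1
  · ext n
    have hint : ∫ θ in (-π)..π, Complex.exp (-(n : ℂ) * θ * Complex.I) * f θ
        = ∫ θ in (-π)..π, fourier (-n) (θ : AddCircle (π - -π)) • f θ := by
      congr! 3 with θ
      rw [fourier_coe_apply, hlen]
      congr 1
      push_cast
      field_simp
    rw [fourierCoeffOn_eq_integral, ← hint, norm_mul, norm_smul, norm_inv, Complex.norm_real,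
      Real.norm_of_nonneg (sqrt_nonneg _), hlen, Real.norm_of_nonneg (by positivity), mul_pow,
      mul_pow, inv_pow, sq_sqrt hpos.le, ← mul_assoc]
    congr 1
    field_simp
  · rw [hlen, smul_eq_mul, mul_inv_cancel_left₀ hpos.ne']

lemma Complex.exists_norm_eq_one_mul_eq_norm (z : ℂ) : ∃ u : ℂ, ‖u‖ = 1 ∧ u * z = ‖z‖ := by
  refine ⟨Complex.exp (-(z.arg : ℂ) * Complex.I), ?_, ?_⟩
  · simpa using Complex.norm_exp_ofReal_mul_I (-z.arg)
  · nth_rw 2 [← Complex.norm_mul_exp_arg_mul_I z]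
    rw [mul_left_comm, ← Complex.exp_add]
    simp

lemma norm_sq_mul_exp_sub_one {u : ℂ} (hu : ‖u‖ = 1) (θ : ℝ) :
    ‖u * Complex.exp (θ * Complex.I) - 1‖ ^ 2
      = 2 - 2 * (u * Complex.exp (θ * Complex.I)).re := by
  have h : ‖u * Complex.exp (θ * Complex.I)‖ ^ 2 = 1 := by
    rw [norm_mul, hu, Complex.norm_exp_ofReal_mul_I]; norm_num
  rw [Complex.sq_norm, Complex.normSq_apply] at h ⊢
  simp only [Complex.sub_re, Complex.sub_im, Complex.one_re, Complex.one_im]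
  linarith

/-- **Chordal version of Judge's relation** (eq. (38) of the paper): for every normalized
`ψ ∈ L²([-π,π])`, with `V_N` the number variance (minimized over integer reference points,
possibly infinite) and `V_cho` the von Mises circular variance,
`√V_N · √V_cho ≥ (1 − V_cho/2)/2`; equivalently `V_N ≥ (2 − V_cho)²/(16 V_cho)` when
`V_cho > 0`. -/
theorem chordal_judge_relation
    (ψ : ℝ → ℂ)
    (hmeas : AEStronglyMeasurable ψ (volume.restrict (Set.Ioc (-π) π)))
    (hnorm : (∫ θ in (-π)..π, ‖ψ θ‖ ^ 2) = 1)
    (ψhat : ℤ → ℂ)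
    (hψhat : ∀ n : ℤ, ψhat n
      = (Real.sqrt (2 * π) : ℂ)⁻¹ * ∫ θ in (-π)..π, Complex.exp (-(n : ℂ) * θ * Complex.I) * ψ θ)
    (VN : ℝ≥0∞)
    (hVN : VN = ⨅ m : ℤ, ∑' n : ℤ, ENNReal.ofReal (((n : ℝ) - (m : ℝ)) ^ 2 * ‖ψhat n‖ ^ 2))
    (Vcho : ℝ)
    (hVcho : Vcho = 2 * (1 - ‖∫ θ in (-π)..π, Complex.exp (θ * Complex.I) * (‖ψ θ‖ ^ 2 : ℂ)‖)) :
    VN ^ (1/2 : ℝ) * ENNReal.ofReal Vcho ^ (1/2 : ℝ)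
        ≥ ENNReal.ofReal ((1 - Vcho / 2) / 2)
      ∧ (0 < Vcho → VN ≥ ENNReal.ofReal ((2 - Vcho) ^ 2 / (16 * Vcho))) := by
 
  set μ := volume.restrict (Set.Ioc (-π) π)
  have hπ : -π ≤ π := by linarith [pi_pos]
  have hnorm_int : IntervalIntegrable (fun θ => ‖ψ θ‖ ^ 2) volume (-π) π :=
    intervalIntegral.intervalIntegrable_of_integral_ne_zero (by simp [hnorm])
  have hL2 : MemLp ψ 2 μ :=
    (memLp_two_iff_integrable_sq_norm hmeas).mpr
      ((intervalIntegrable_iff_integrableOn_Ioc_of_le hπ).mp hnorm_int)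
  set z := ∫ θ in (-π)..π, Complex.exp (θ * Complex.I) * (‖ψ θ‖ ^ 2 : ℂ) with hz
  obtain ⟨u, hu, huz⟩ := z.exists_norm_eq_one_mul_eq_norm
  have ha : HasSum (fun n => ‖ψhat n‖ ^ 2) 1 := by
    simpa only [hψhat, hnorm] using hasSum_sq_norm_fourierIntegral hL2
  have hexp (n : ℤ) : Continuous fun θ : ℝ => Complex.exp (-(n : ℂ) * θ * Complex.I) := by fun_prop
  have hW : HasSum (fun n => ‖u * ψhat (n - 1) - ψhat n‖ ^ 2) Vcho := by
    have hg : MemLp (fun θ : ℝ => (u * Complex.exp (θ * Complex.I) - 1) * ψ θ) 2 μ := by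
      refine hL2.of_le_mul (c := 2) ?_ (.of_forall fun θ => ?_)
      · exact (by fun_prop : Continuous fun θ : ℝ => u * Complex.exp (θ * Complex.I) - 1)
          |>.aestronglyMeasurable.mul hmeas
      · rw [norm_mul]
        gcongr
        calc _ ≤ ‖u * Complex.exp (θ * Complex.I)‖ + ‖(1 : ℂ)‖ := norm_sub_le _ _
          _ = 2 := by rw [norm_mul, hu, Complex.norm_exp_ofReal_mul_I]; norm_num
    have hψint : IntervalIntegrable ψ volume (-π) π :=
      (intervalIntegrable_iff_integrableOn_Ioc_of_le hπ).mpr (hL2.integrable one_le_two)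
    have hcoeff (n : ℤ) : (√(2 * π) : ℂ)⁻¹ * ∫ θ in (-π)..π, Complex.exp (-(n : ℂ) * θ * Complex.I)
        * ((u * Complex.exp (θ * Complex.I) - 1) * ψ θ) = u * ψhat (n - 1) - ψhat n := by
      have hsplit (θ : ℝ) : Complex.exp (-(n : ℂ) * θ * Complex.I)
            * ((u * Complex.exp (θ * Complex.I) - 1) * ψ θ)
          = u * (Complex.exp (-((n - 1 : ℤ) : ℂ) * θ * Complex.I) * ψ θ)
            - Complex.exp (-(n : ℂ) * θ * Complex.I) * ψ θ := by
        have : Complex.exp (-((n - 1 : ℤ) : ℂ) * θ * Complex.I)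
            = Complex.exp (-(n : ℂ) * θ * Complex.I) * Complex.exp (θ * Complex.I) := by
          rw [← Complex.exp_add]
          push_cast
          ring_nf
        rw [this]
        ring
      simp only [hsplit]
      rw [intervalIntegral.integral_sub, intervalIntegral.integral_const_mul, hψhat, hψhat]
      · ring
      · exact (hψint.continuousOn_mul (hexp _).continuousOn).const_mul u
      · exact hψint.continuousOn_mul (hexp _).continuousOn
    have h := hasSum_sq_norm_fourierIntegral hg
    simp only [hcoeff] at h
    convert! h using 1
    have hzint : IntervalIntegrable
        (fun θ : ℝ => u * (Complex.exp (θ * Complex.I) * (‖ψ θ‖ ^ 2 : ℂ))) volume (-π) π := by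
      refine IntervalIntegrable.const_mul (.continuousOn_mul ?_ (by fun_prop)) u
      exact_mod_cast (⟨hnorm_int.1.ofReal, hnorm_int.2.ofReal⟩ :
        IntervalIntegrable (fun θ => ((‖ψ θ‖ ^ 2 : ℝ) : ℂ)) volume (-π) π)
    have hre : ∫ θ in (-π)..π, (u * (Complex.exp (θ * Complex.I) * (‖ψ θ‖ ^ 2 : ℂ))).re = ‖z‖ := by
      have := Complex.reCLM.intervalIntegral_comp_comm hzint
      simp only [Complex.reCLM_apply] at this
      rw [this, intervalIntegral.integral_const_mul, ← hz, huz, Complex.ofReal_re]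
    have hpt (θ : ℝ) : ‖(u * Complex.exp (θ * Complex.I) - 1) * ψ θ‖ ^ 2
        = 2 * ‖ψ θ‖ ^ 2 - 2 * (u * (Complex.exp (θ * Complex.I) * (‖ψ θ‖ ^ 2 : ℂ))).re := by
      rw [norm_mul, mul_pow, norm_sq_mul_exp_sub_one hu, ← mul_assoc, ← Complex.ofReal_pow,
        Complex.re_mul_ofReal]
      ring
    simp only [hpt]
    rw [intervalIntegral.integral_sub (hnorm_int.const_mul 2), intervalIntegral.integral_const_mul,
      intervalIntegral.integral_const_mul, hnorm, hre, hVcho]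
    · ring
    · exact IntervalIntegrable.const_mul ⟨hzint.1.re, hzint.2.re⟩ 2
  have hWpos : 0 < Vcho := shift_defect_pos hu ha hW
  have hr : 0 ≤ 1 - Vcho / 2 := by
    rw [hVcho]
    linarith [norm_nonneg z]
  have hmain : ENNReal.ofReal ((2 - Vcho) ^ 2 / (16 * Vcho)) ≤ VN := by
    rw [hVN]
    refine le_iInf fun m => ?_
    by_cases hs : ∑' n : ℤ, ENNReal.ofReal (((n : ℝ) - m) ^ 2 * ‖ψhat n‖ ^ 2) = ∞
    · simp [hs]
    have hsum : Summable fun n : ℤ => ((n : ℝ) - m) ^ 2 * ‖ψhat n‖ ^ 2 := by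
      refine (ENNReal.summable_toReal hs).congr fun n => ENNReal.toReal_ofReal (by positivity)
    rw [← ENNReal.ofReal_tsum_of_nonneg (fun n => by positivity) hsum]
    refine ENNReal.ofReal_le_ofReal ?_
    rw [div_le_iff₀ (by positivity)]
    linarith [sq_le_variance_mul_shift_defect hu m ha hW hsum.hasSum]
  refine ⟨?_, fun _ => hmain⟩
  calc ENNReal.ofReal ((1 - Vcho / 2) / 2)
      = (ENNReal.ofReal ((2 - Vcho) ^ 2 / (16 * Vcho)) * ENNReal.ofReal Vcho) ^ (1 / 2 : ℝ) := by
        rw [← ENNReal.ofReal_mul (by positivity),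
          ENNReal.ofReal_rpow_of_nonneg (by positivity) (by norm_num), ← Real.sqrt_eq_rpow]
        congr 1
        rw [eq_comm, Real.sqrt_eq_iff_mul_self_eq (by positivity) (by positivity)]
        field_simp
        ring
    _ = ENNReal.ofReal ((2 - Vcho) ^ 2 / (16 * Vcho)) ^ (1 / 2 : ℝ)
          * ENNReal.ofReal Vcho ^ (1 / 2 : ℝ) := ENNReal.mul_rpow_of_nonneg _ _ (by norm_num)
    _ ≤ VN ^ (1 / 2 : ℝ) * ENNReal.ofReal Vcho ^ (1 / 2 : ℝ) := by gcongr
end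

section
/- Sharp uncertainty relation for the discrete metric on ℤ and the chordal metric on the circle: let ψ ∈ L²([-π,π]) be a unit vector with Fourier coefficients ψ̂(n) = (2π)^{-1/2}∫_{-π}^{π} e^{-inθ}ψ(θ)dθ. Define the discrete-metric number deviation Δ_di(ψ) = 1 − sup_{n∈ℤ}|ψ̂(n)|² and the circular variance V_cho(ψ) = 2(1 − |∫_{-π}^{π} e^{iθ}|ψ(θ)|² dθ|). Then Δ_di(ψ) ≥ 1 − (1/2)·√( V_cho(ψ)·(4 − V_cho(ψ)) ); equivalently, sup_{n∈ℤ}|ψ̂(n)|² ≤ (1/2)·√( V_cho(ψ)·(4 − V_cho(ψ)) ). -/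
open MeasureTheory Real

/-- The total mass of the inverse square distance from the unit circle to a point of the disk. -/
lemma integral_inv_norm_exp_sub_sq {z : ℂ} (hz : ‖z‖ < 1) :
    ∫ θ in (-π)..π, (‖Complex.exp (θ * Complex.I) - z‖ ^ 2)⁻¹ = 2 * π / (1 - ‖z‖ ^ 2) := by
  have hden : 1 - ‖z‖ ^ 2 ≠ 0 := by nlinarith [norm_nonneg z]
  have hper : Function.Periodic
      (fun θ : ℝ ↦ (‖Complex.exp (θ * Complex.I) - z‖ ^ 2)⁻¹) (2 * π) := by
    intro θ
    simp only [Complex.ofReal_add, Complex.ofReal_mul, Complex.ofReal_ofNat, add_mul,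
      Complex.exp_add, Complex.exp_two_pi_mul_I, mul_one]
  have hshift := hper.intervalIntegral_add_eq (-π) 0
  rw [show -π + 2 * π = π by ring, zero_add] at hshift
  have hP := DiffContOnCl.circleAverage_poissonKernel_smul' (f := fun _ ↦ (1 : ℂ)) (w := z)
    (c := 0) (R := 1) diffContOnCl_const (by simpa using hz)
  simp only [circleAverage_def, sub_zero, circleMap, zero_add, Complex.ofReal_one, one_mul,
    Complex.norm_exp_ofReal_mul_I, one_pow, Complex.real_smul, mul_one, div_eq_mul_inv] at hP
  rw [intervalIntegral.integral_ofReal, intervalIntegral.integral_const_mul] at hP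
  norm_cast at hP
  rw [hshift, eq_div_iff hden, mul_comm]
  rwa [inv_mul_eq_one₀ (by positivity), eq_comm] at hP

lemma continuous_inv_norm_exp_sub_sq {z : ℂ} (hz : ‖z‖ < 1) :
    Continuous fun θ : ℝ ↦ (‖Complex.exp (θ * Complex.I) - z‖ ^ 2)⁻¹ := by
  refine Continuous.inv₀ (by fun_prop) fun θ ↦ ?_
  have hne : Complex.exp (θ * Complex.I) - z ≠ 0 := by
    intro h
    rw [← sub_eq_zero.mp h, Complex.norm_exp_ofReal_mul_I] at hz
    exact lt_irrefl _ hz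
  positivity

lemma norm_exp_sub_sq (θ : ℝ) (z : ℂ) :
    ‖Complex.exp (θ * Complex.I) - z‖ ^ 2
      = 1 + ‖z‖ ^ 2 - 2 * (starRingEnd ℂ z * Complex.exp (θ * Complex.I)).re := by
  rw [← Complex.normSq_eq_norm_sq, Complex.normSq_sub, Complex.normSq_eq_norm_sq,
    Complex.normSq_eq_norm_sq, Complex.norm_exp_ofReal_mul_I, mul_comm (starRingEnd ℂ z)]
  ring

/-- Mean of `‖e^{iθ} - z‖²` under the angle distribution of a normalized `ψ`. -/
lemma integral_norm_sq_mul_norm_exp_sub_sq {ψ : ℝ → ℂ}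
    (hint : IntervalIntegrable (fun θ ↦ ‖ψ θ‖ ^ 2) volume (-π) π)
    (hnorm : (∫ θ in (-π)..π, ‖ψ θ‖ ^ 2) = 1) (z : ℂ) :
    ∫ θ in (-π)..π, ‖ψ θ‖ ^ 2 * ‖Complex.exp (θ * Complex.I) - z‖ ^ 2
      = 1 + ‖z‖ ^ 2 - 2 * (starRingEnd ℂ z *
          ∫ θ in (-π)..π, Complex.exp (θ * Complex.I) * (‖ψ θ‖ ^ 2 : ℂ)).re := by
  have hintC : IntervalIntegrable (fun θ ↦ (‖ψ θ‖ ^ 2 : ℂ)) volume (-π) π := by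
    exact_mod_cast (⟨hint.1.ofReal, hint.2.ofReal⟩ :
      IntervalIntegrable (fun θ ↦ ((‖ψ θ‖ ^ 2 : ℝ) : ℂ)) volume (-π) π)
  have hexp : IntervalIntegrable
      (fun θ : ℝ ↦ starRingEnd ℂ z * (Complex.exp (θ * Complex.I) * (‖ψ θ‖ ^ 2 : ℂ)))
      volume (-π) π :=
    (hintC.continuousOn_mul (by fun_prop)).const_mul _
  have hre : IntervalIntegrable
      (fun θ : ℝ ↦ (starRingEnd ℂ z * (Complex.exp (θ * Complex.I) * (‖ψ θ‖ ^ 2 : ℂ))).re)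
      volume (-π) π :=
    ⟨hexp.1.re, hexp.2.re⟩
  have hcomm := Complex.reCLM.intervalIntegral_comp_comm hexp
  simp only [Complex.reCLM_apply] at hcomm
  have hmass : 1 + ‖z‖ ^ 2 = ∫ θ in (-π)..π, (1 + ‖z‖ ^ 2) * ‖ψ θ‖ ^ 2 := by
    rw [intervalIntegral.integral_const_mul, hnorm, mul_one]
  rw [← intervalIntegral.integral_const_mul, ← hcomm, ← intervalIntegral.integral_const_mul,
    hmass, ← intervalIntegral.integral_sub (hint.const_mul _) (hre.const_mul _)]
  refine intervalIntegral.integral_congr fun θ _ ↦ ?_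
  have hcast : (starRingEnd ℂ z * (Complex.exp (θ * Complex.I) * (‖ψ θ‖ ^ 2 : ℂ))).re
      = (starRingEnd ℂ z * Complex.exp (θ * Complex.I)).re * ‖ψ θ‖ ^ 2 := by
    rw [← mul_assoc, ← Complex.ofReal_pow, Complex.re_mul_ofReal]
  simp only [norm_exp_sub_sq, hcast]
  ring

/-- Weighted Cauchy–Schwarz bound for the `L¹` norm of `ψ`. -/
lemma sq_integral_norm_le {ψ : ℝ → ℂ}
    (hmeas : AEStronglyMeasurable ψ (volume.restrict (Set.Ioc (-π) π)))
    (hnorm : (∫ θ in (-π)..π, ‖ψ θ‖ ^ 2) = 1) {z : ℂ} (hz : ‖z‖ < 1) :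
    (∫ θ in (-π)..π, ‖ψ θ‖) ^ 2 * (1 - ‖z‖ ^ 2) ≤ 2 * π * (1 + ‖z‖ ^ 2 - 2 * (starRingEnd ℂ z *
      ∫ θ in (-π)..π, Complex.exp (θ * Complex.I) * (‖ψ θ‖ ^ 2 : ℂ)).re) := by
  have hpi : -π ≤ π := by linarith [pi_pos]
  have hden : 0 < 1 - ‖z‖ ^ 2 := by nlinarith [norm_nonneg z]
  have hint : IntervalIntegrable (fun θ ↦ ‖ψ θ‖ ^ 2) volume (-π) π := by
    by_contra h
    simp [intervalIntegral.integral_undef h] at hnorm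
  have hint1 : IntervalIntegrable (fun θ ↦ ‖ψ θ‖) volume (-π) π := by
    rw [intervalIntegrable_iff_integrableOn_Ioc_of_le hpi] at hint ⊢
    exact (((memLp_two_iff_integrable_sq_norm hmeas).2 hint).integrable one_le_two).norm
  have hintw : IntervalIntegrable
      (fun θ : ℝ ↦ ‖ψ θ‖ ^ 2 * ‖Complex.exp (θ * Complex.I) - z‖ ^ 2) volume (-π) π :=
    hint.mul_continuousOn (by fun_prop)
  have hintv := (continuous_inv_norm_exp_sub_sq hz).intervalIntegrable (μ := volume) (-π) π
  have hquad (t : ℝ) : 0 ≤ (∫ θ in (-π)..π, ‖ψ θ‖ ^ 2 * ‖Complex.exp (θ * Complex.I) - z‖ ^ 2)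
      - 2 * t * (∫ θ in (-π)..π, ‖ψ θ‖) + t ^ 2 * (2 * π / (1 - ‖z‖ ^ 2)) := by
    rw [← integral_inv_norm_exp_sub_sq hz, ← intervalIntegral.integral_const_mul,
      ← intervalIntegral.integral_const_mul,
      ← intervalIntegral.integral_sub hintw (hint1.const_mul _),
      ← intervalIntegral.integral_add (hintw.sub (hint1.const_mul _)) (hintv.const_mul _)]
    refine intervalIntegral.integral_nonneg hpi fun θ _ ↦ ?_
    have hne : ‖Complex.exp (θ * Complex.I) - z‖ ≠ 0 := by
      intro h
      rw [← sub_eq_zero.mp (norm_eq_zero.mp h), Complex.norm_exp_ofReal_mul_I] at hz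
      exact lt_irrefl _ hz
    have hsq : 0 ≤ (‖ψ θ‖ * ‖Complex.exp (θ * Complex.I) - z‖
      - t * ‖Complex.exp (θ * Complex.I) - z‖⁻¹) ^ 2 := sq_nonneg _
    convert hsq using 1
    field_simp
    ring
  rw [integral_norm_sq_mul_norm_exp_sub_sq hint hnorm z] at hquad
  have hmin := hquad ((∫ θ in (-π)..π, ‖ψ θ‖) * (1 - ‖z‖ ^ 2) / (2 * π))
  have hpos := pi_pos
  set A := 1 + ‖z‖ ^ 2 - 2 * (starRingEnd ℂ z *
      ∫ θ in (-π)..π, Complex.exp (θ * Complex.I) * (‖ψ θ‖ ^ 2 : ℂ)).re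
  set B := ∫ θ in (-π)..π, ‖ψ θ‖
  have hval : A - 2 * (B * (1 - ‖z‖ ^ 2) / (2 * π)) * B
      + (B * (1 - ‖z‖ ^ 2) / (2 * π)) ^ 2 * (2 * π / (1 - ‖z‖ ^ 2))
      = A - B ^ 2 * (1 - ‖z‖ ^ 2) / (2 * π) := by
    field_simp
    ring
  rw [hval, sub_nonneg, div_le_iff₀ (by positivity)] at hmin
  linarith

/-- Optimizing the pole of the weight: a number `p` bounded by every Poisson-weighted mean is
bounded by `√(1 - ‖R‖²)`. -/
lemma le_sqrt_one_sub_norm_sq {p : ℝ} {R : ℂ} (hR : ‖R‖ ≤ 1)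
    (h : ∀ z : ℂ, ‖z‖ < 1 →
      p * (1 - ‖z‖ ^ 2) ≤ 1 + ‖z‖ ^ 2 - 2 * (starRingEnd ℂ z * R).re) :
    p ≤ √(1 - ‖R‖ ^ 2) := by
  have hreal (t : ℝ) (ht0 : 0 ≤ t) (ht : t * ‖R‖ < 1) :
      p * (1 - (t * ‖R‖) ^ 2) ≤ 1 + (t * ‖R‖) ^ 2 - 2 * (t * ‖R‖ ^ 2) := by
    have hz : ‖(t : ℂ) * R‖ = t * ‖R‖ := by simp [abs_of_nonneg ht0]
    have hre : (starRingEnd ℂ ((t : ℂ) * R) * R).re = t * ‖R‖ ^ 2 := by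
      rw [map_mul, Complex.conj_ofReal, mul_assoc, Complex.re_ofReal_mul, mul_comm _ R,
        Complex.mul_conj, Complex.ofReal_re, Complex.normSq_eq_norm_sq]
    have ht' := h ((t : ℂ) * R) (hz ▸ ht)
    rwa [hz, hre] at ht'
  rcases hR.lt_or_eq with hlt | heq
  · have hs : 0 < 1 - ‖R‖ ^ 2 := by nlinarith [norm_nonneg R]
    set s := √(1 - ‖R‖ ^ 2)
    have hs0 : 0 < s := Real.sqrt_pos.2 hs
    have hss : s ^ 2 = 1 - ‖R‖ ^ 2 := Real.sq_sqrt hs.le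
    have hRs : ‖R‖ ^ 2 = (1 - s) * (1 + s) := by linarith
    have hpole := hreal (1 + s)⁻¹ (by positivity)
      (by rw [inv_mul_lt_iff₀ (by positivity)]; linarith)
    rw [mul_pow, hRs] at hpole
    have h1 : 1 - ((1 + s)⁻¹) ^ 2 * ((1 - s) * (1 + s)) = 2 * s / (1 + s) := by
      field_simp
      ring
    have h2 : 1 + ((1 + s)⁻¹) ^ 2 * ((1 - s) * (1 + s)) - 2 * ((1 + s)⁻¹ * ((1 - s) * (1 + s)))
        = s * (2 * s / (1 + s)) := by
      field_simp
      ring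
    rw [h1, h2] at hpole
    exact le_of_mul_le_mul_right hpole (by positivity)
  · rw [heq] at hreal ⊢
    by_contra! hcon
    simp only [one_pow, sub_self, Real.sqrt_zero] at hcon
    have h0 := hreal 0 le_rfl (by norm_num)
    have hpole := hreal (1 - p / 2) (by nlinarith) (by nlinarith)
    nlinarith [mul_pos hcon hcon]

/-- **Sharp discrete–chordal uncertainty relation** (eq. (10) of the paper): for every
normalized `ψ ∈ L²([-π,π])`, the discrete-metric number deviation
`Δ_di(ψ) = 1 − sup_n |ψ̂(n)|²` and the circular variance
`V_cho(ψ) = 2(1 − |∫ e^{iθ}|ψ(θ)|²dθ|)` satisfy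
`Δ_di(ψ) ≥ 1 − (1/2)√(V_cho(ψ)(4 − V_cho(ψ)))`. -/
theorem discrete_chordal_uncertainty
    (ψ : ℝ → ℂ)
    (hmeas : AEStronglyMeasurable ψ (volume.restrict (Set.Ioc (-π) π)))
    (hnorm : (∫ θ in (-π)..π, ‖ψ θ‖ ^ 2) = 1)
    (ψhat : ℤ → ℂ)
    (hψhat : ∀ n : ℤ, ψhat n
      = (Real.sqrt (2 * π) : ℂ)⁻¹ * ∫ θ in (-π)..π, Complex.exp (-(n : ℂ) * θ * Complex.I) * ψ θ)
    (Vcho : ℝ)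
    (hVcho : Vcho = 2 * (1 - ‖∫ θ in (-π)..π, Complex.exp (θ * Complex.I) * (‖ψ θ‖ ^ 2 : ℂ)‖)) :
    1 - (⨆ n : ℤ, ‖ψhat n‖ ^ 2) ≥ 1 - (1/2) * Real.sqrt (Vcho * (4 - Vcho)) := by
  have hpi : -π ≤ π := by linarith [pi_pos]
  have hR : ‖∫ θ in (-π)..π, Complex.exp (θ * Complex.I) * (‖ψ θ‖ ^ 2 : ℂ)‖ ≤ 1 := by
    refine (intervalIntegral.norm_integral_le_integral_norm hpi).trans_eq ?_
    simpa [Complex.norm_exp_ofReal_mul_I] using hnorm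
  have hweight := fun (z : ℂ) (hz : ‖z‖ < 1) ↦ sq_integral_norm_le hmeas hnorm hz
  set R := ∫ θ in (-π)..π, Complex.exp (θ * Complex.I) * (‖ψ θ‖ ^ 2 : ℂ)
  have hsqrt : 1 / 2 * √(Vcho * (4 - Vcho)) = √(1 - ‖R‖ ^ 2) := by
    rw [hVcho, show 2 * (1 - ‖R‖) * (4 - 2 * (1 - ‖R‖)) = 2 ^ 2 * (1 - ‖R‖ ^ 2) by ring,
      Real.sqrt_mul (by norm_num), Real.sqrt_sq (by norm_num)]
    ring
  have hcoeff (n : ℤ) : ‖ψhat n‖ ^ 2 ≤ (∫ θ in (-π)..π, ‖ψ θ‖) ^ 2 / (2 * π) := by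
    have hle : ‖∫ θ in (-π)..π, Complex.exp (-(n : ℂ) * θ * Complex.I) * ψ θ‖
        ≤ ∫ θ in (-π)..π, ‖ψ θ‖ := by
      refine (intervalIntegral.norm_integral_le_integral_norm hpi).trans_eq ?_
      refine intervalIntegral.integral_congr fun θ _ ↦ ?_
      simp [Complex.norm_exp]
    rw [hψhat, norm_mul, mul_pow, norm_inv, Complex.norm_real, Real.norm_eq_abs, inv_pow, sq_abs,
      Real.sq_sqrt (by positivity), div_eq_inv_mul]
    gcongr
  rw [hsqrt, ge_iff_le, sub_le_sub_iff_left]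
  refine ciSup_le fun n ↦ (hcoeff n).trans
    (le_sqrt_one_sub_norm_sq hR fun z hz ↦ ?_)
  rw [div_mul_eq_mul_div, div_le_iff₀ (by positivity), mul_comm _ (2 * π)]
  exact hweight z hz
end

section
/- Saturation of the discrete–chordal uncertainty relation: for μ > 0 let ψ_μ ∈ L²([-π,π]) be the unit vector ψ_μ(θ) = C_μ / (μ + 2(1 − cos θ)), where C_μ > 0 is the normalization constant. Then ψ_μ achieves equality in the discrete–chordal tradeoff: with V = V_cho(ψ_μ) = 2(1 − |∫_{-π}^{π} e^{iθ}|ψ_μ(θ)|² dθ|) one has sup_{n∈ℤ}|ψ̂_μ(n)|² = |ψ̂_μ(0)|² = (1/2)·√( V·(4 − V) ). -/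
open MeasureTheory Real

section PoissonIntegrals

variable {a : ℝ}

lemma sub_two_mul_cos_pos (ha : 2 < a) (θ : ℝ) : 0 < a - 2 * Real.cos θ := by
  linarith [Real.cos_le_one θ]

lemma continuous_inv_sub_two_mul_cos (ha : 2 < a) :
    Continuous fun θ : ℝ => (a - 2 * Real.cos θ)⁻¹ :=
  Continuous.inv₀ (by fun_prop) fun θ => (sub_two_mul_cos_pos ha θ).ne'

lemma integral_inv_sub_two_mul_cos (ha : 2 < a) :
    ∫ θ in (-π)..π, (a - 2 * Real.cos θ)⁻¹ = 2 * π / √(a ^ 2 - 4) := by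
  have h4 : 0 < a ^ 2 - 4 := by nlinarith
  set s := √(a ^ 2 - 4) with hs
  have hs0 : 0 < s := Real.sqrt_pos.mpr h4
  have hs2 : s ^ 2 = a ^ 2 - 4 := Real.sq_sqrt h4.le
  obtain ⟨r, hr⟩ : ∃ r, r = (a - s) / 2 := ⟨_, rfl⟩
  have hquad : r ^ 2 - a * r + 1 = 0 := by rw [hr]; nlinarith
  have hsr : s = a - 2 * r := by rw [hr]; ring
  have hr0 : 0 < r := by rw [hr]; nlinarith
  have hr1 : r < 1 := by
    rw [hr]; nlinarith
  have key : ∀ θ : ℝ, HasDerivAt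
      (fun θ => (θ + 2 * Real.arctan (r * Real.sin θ / (1 - r * Real.cos θ))) / s)
      ((a - 2 * Real.cos θ)⁻¹) θ := by
    intro θ
    have hd : 0 < 1 - r * Real.cos θ := by nlinarith [Real.cos_le_one θ]
    have hD := sub_two_mul_cos_pos ha θ
    have h1 : HasDerivAt (fun θ => r * Real.sin θ / (1 - r * Real.cos θ)) _ θ :=
      ((Real.hasDerivAt_sin θ).const_mul r).div
        (((Real.hasDerivAt_cos θ).const_mul r).const_sub 1) hd.ne'
    refine (((hasDerivAt_id θ).add (h1.arctan.const_mul 2)).div_const s).congr_deriv ?_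
    have hsum : 1 + (r * Real.sin θ / (1 - r * Real.cos θ)) ^ 2
        = r * (a - 2 * Real.cos θ) / (1 - r * Real.cos θ) ^ 2 := by
      field_simp
      linear_combination r ^ 2 * Real.sin_sq_add_cos_sq θ + hquad
    rw [hsum]
    have hd' := hd.ne'
    have hD' := hD.ne'
    field_simp
    rw [hsr]
    linear_combination (-2 * r) * Real.sin_sq_add_cos_sq θ
  rw [intervalIntegral.integral_eq_sub_of_hasDerivAt (fun θ _ => key θ)
    ((continuous_inv_sub_two_mul_cos ha).intervalIntegrable _ _)]
  simp
  ring

lemma integral_inv_sub_two_mul_cos_sq (ha : 2 < a) :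
    (a ^ 2 - 4) * ∫ θ in (-π)..π, ((a - 2 * Real.cos θ)⁻¹) ^ 2
      = a * ∫ θ in (-π)..π, (a - 2 * Real.cos θ)⁻¹ := by
  have hc := continuous_inv_sub_two_mul_cos ha
  have key : ∀ θ : ℝ, HasDerivAt (fun θ => 2 * (Real.sin θ * (a - 2 * Real.cos θ)⁻¹))
      ((a ^ 2 - 4) * ((a - 2 * Real.cos θ)⁻¹) ^ 2 - a * (a - 2 * Real.cos θ)⁻¹) θ := by
    intro θ
    have hD := (sub_two_mul_cos_pos ha θ).ne'
    refine (((Real.hasDerivAt_sin θ).mul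
      ((((Real.hasDerivAt_cos θ).const_mul 2).const_sub a).inv hD)).const_mul 2).congr_deriv ?_
    rw [Pi.inv_apply]
    field_simp
    linear_combination (-4) * Real.sin_sq_add_cos_sq θ
  have h := intervalIntegral.integral_eq_sub_of_hasDerivAt (a := -π) (b := π)
    (fun θ _ => key θ) (Continuous.intervalIntegrable (by fun_prop) _ _)
  rw [intervalIntegral.integral_sub (Continuous.intervalIntegrable (by fun_prop) _ _)
    (Continuous.intervalIntegrable (by fun_prop) _ _), intervalIntegral.integral_const_mul,
    intervalIntegral.integral_const_mul] at h
  simp only [Real.sin_pi, Real.sin_neg, neg_zero, zero_mul, mul_zero, sub_zero] at h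
  linarith

lemma integral_cos_mul_inv_sub_two_mul_cos_sq (ha : 2 < a) :
    a * ∫ θ in (-π)..π, Real.cos θ * ((a - 2 * Real.cos θ)⁻¹) ^ 2
      = 2 * ∫ θ in (-π)..π, ((a - 2 * Real.cos θ)⁻¹) ^ 2 := by
  have hc := continuous_inv_sub_two_mul_cos ha
  have h1 : ∀ θ : ℝ, Real.cos θ * ((a - 2 * Real.cos θ)⁻¹) ^ 2
      = a / 2 * ((a - 2 * Real.cos θ)⁻¹) ^ 2 - 1 / 2 * (a - 2 * Real.cos θ)⁻¹ := by
    intro θ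
    have hD := (sub_two_mul_cos_pos ha θ).ne'
    field_simp
    ring
  simp_rw [h1]
  rw [intervalIntegral.integral_sub (Continuous.intervalIntegrable (by fun_prop) _ _)
    (Continuous.intervalIntegrable (by fun_prop) _ _), intervalIntegral.integral_const_mul,
    intervalIntegral.integral_const_mul]
  linarith [integral_inv_sub_two_mul_cos_sq ha]

end PoissonIntegrals

lemma integral_eq_zero_of_odd {f : ℝ → ℝ} (hf : ∀ x, f (-x) = -f x) (b : ℝ) :
    ∫ x in (-b)..b, f x = 0 := by
  have h := intervalIntegral.integral_comp_neg (a := -b) (b := b) f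
  simp only [hf, intervalIntegral.integral_neg, neg_neg] at h
  linarith

/-- The first trigonometric moment of an even real density is its cosine moment. -/
lemma integral_exp_mul_I_mul_of_even {w : ℝ → ℝ} (hw : Continuous w) (heven : ∀ x, w (-x) = w x)
    (b : ℝ) : ∫ θ in (-b)..b, Complex.exp (θ * Complex.I) * (w θ : ℂ)
      = ((∫ θ in (-b)..b, Real.cos θ * w θ : ℝ) : ℂ) := by
  have h1 : ∀ θ : ℝ, Complex.exp (θ * Complex.I) * (w θ : ℂ)
      = ((Real.cos θ * w θ : ℝ) : ℂ) + ((Real.sin θ * w θ : ℝ) : ℂ) * Complex.I := by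
    intro θ
    rw [Complex.exp_mul_I]
    push_cast
    ring
  simp_rw [h1]
  rw [intervalIntegral.integral_add (Continuous.intervalIntegrable (by fun_prop) _ _)
    (Continuous.intervalIntegrable (by fun_prop) _ _), intervalIntegral.integral_mul_const,
    intervalIntegral.integral_ofReal, intervalIntegral.integral_ofReal,
    integral_eq_zero_of_odd (f := fun θ => Real.sin θ * w θ) (fun x => by simp [heven])]
  simp

/-- **Saturation of the discrete–chordal uncertainty relation**: for `μ > 0`, the normalized
positive state `ψ_μ(θ) = C_μ/(μ + 2(1 − cos θ))` achieves equality in the discrete–chordal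
tradeoff: with `V = V_cho(ψ_μ)` one has `sup_n |ψ̂_μ(n)|² = |ψ̂_μ(0)|² = (1/2)√(V(4 − V))`. -/
theorem discrete_chordal_saturation
    (μ : ℝ) (hμ : 0 < μ) (C : ℝ) (hC : 0 < C)
    (ψ : ℝ → ℂ)
    (hψ : ∀ θ : ℝ, ψ θ = ((C / (μ + 2 * (1 - Real.cos θ)) : ℝ) : ℂ))
    (hnorm : (∫ θ in (-π)..π, ‖ψ θ‖ ^ 2) = 1)
    (ψhat : ℤ → ℂ)
    (hψhat : ∀ n : ℤ, ψhat n
      = (Real.sqrt (2 * π) : ℂ)⁻¹ * ∫ θ in (-π)..π, Complex.exp (-(n : ℂ) * θ * Complex.I) * ψ θ)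
    (V : ℝ)
    (hV : V = 2 * (1 - ‖∫ θ in (-π)..π, Complex.exp (θ * Complex.I) * (‖ψ θ‖ ^ 2 : ℂ)‖)) :
    (⨆ n : ℤ, ‖ψhat n‖ ^ 2) = ‖ψhat 0‖ ^ 2
      ∧ ‖ψhat 0‖ ^ 2 = (1/2) * Real.sqrt (V * (4 - V)) := by
  obtain ⟨a, rfl⟩ : ∃ a, μ = a - 2 := ⟨μ + 2, by ring⟩
  have ha : 2 < a := by linarith
  have h4 : 0 < a ^ 2 - 4 := by nlinarith
  have hs0 : 0 < √(a ^ 2 - 4) := Real.sqrt_pos.mpr h4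
  have hs2 : √(a ^ 2 - 4) ^ 2 = a ^ 2 - 4 := Real.sq_sqrt h4.le
  have hc := continuous_inv_sub_two_mul_cos ha
  have hψ' : ∀ θ : ℝ, ψ θ = ((C * (a - 2 * Real.cos θ)⁻¹ : ℝ) : ℂ) := by
    intro θ
    rw [hψ, div_eq_mul_inv]
    ring_nf
  have hnormψ : ∀ θ : ℝ, ‖ψ θ‖ = C * (a - 2 * Real.cos θ)⁻¹ := by
    intro θ
    rw [hψ', Complex.norm_real, Real.norm_of_nonneg]
    have := sub_two_mul_cos_pos ha θ
    positivity
  have hI1 := integral_inv_sub_two_mul_cos ha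
  have hI2 := integral_inv_sub_two_mul_cos_sq ha
  have hI3 := integral_cos_mul_inv_sub_two_mul_cos_sq ha
  have hN : C ^ 2 * ∫ θ in (-π)..π, ((a - 2 * Real.cos θ)⁻¹) ^ 2 = 1 := by
    rw [← hnorm, ← intervalIntegral.integral_const_mul]
    simp_rw [hnormψ, mul_pow]
  have hpi : 0 < 2 * π := by positivity
  have hhat0 : ‖ψhat 0‖ = (√(2 * π))⁻¹ * ∫ θ in (-π)..π, ‖ψ θ‖ := by
    have hnonneg : 0 ≤ ∫ θ in (-π)..π, C * (a - 2 * Real.cos θ)⁻¹ := by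
      rw [intervalIntegral.integral_const_mul, hI1]
      positivity
    simp_rw [hnormψ]
    rw [hψhat]
    simp only [Int.cast_zero, neg_zero, zero_mul, Complex.exp_zero, one_mul, hψ']
    rw [intervalIntegral.integral_ofReal, norm_mul, norm_inv, Complex.norm_real, Complex.norm_real,
      Real.norm_of_nonneg (Real.sqrt_nonneg _), Real.norm_of_nonneg hnonneg]
  have hle : ∀ n, ‖ψhat n‖ ^ 2 ≤ ‖ψhat 0‖ ^ 2 := by
    intro n
    gcongr
    rw [hhat0, hψhat, norm_mul, norm_inv, Complex.norm_real,
      Real.norm_of_nonneg (Real.sqrt_nonneg _)]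
    gcongr
    refine (intervalIntegral.norm_integral_le_integral_norm (by linarith)).trans_eq ?_
    refine intervalIntegral.integral_congr fun θ _ => ?_
    have : -(n : ℂ) * θ * Complex.I = ((-(n : ℝ) * θ : ℝ) : ℂ) * Complex.I := by push_cast; ring
    simp only [this, norm_mul, Complex.norm_exp_ofReal_mul_I, one_mul]
  refine ⟨le_antisymm (ciSup_le hle) (le_ciSup (f := fun n => ‖ψhat n‖ ^ 2)
    ⟨_, Set.forall_mem_range.mpr hle⟩ 0), ?_⟩
  have hmoment : ∫ θ in (-π)..π, Complex.exp (θ * Complex.I) * (‖ψ θ‖ ^ 2 : ℂ)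
      = ((2 / a : ℝ) : ℂ) := by
    have h := integral_exp_mul_I_mul_of_even (w := fun θ => ‖ψ θ‖ ^ 2)
      (by simp_rw [hnormψ]; fun_prop) (fun θ => by simp [hnormψ]) π
    simp only [Complex.ofReal_pow] at h
    rw [h]
    congr 1
    simp_rw [hnormψ, mul_pow, mul_left_comm _ (C ^ 2)]
    rw [intervalIntegral.integral_const_mul, eq_div_iff (by positivity)]
    linear_combination C ^ 2 * hI3 + 2 * hN
  rw [hmoment, Complex.norm_real, Real.norm_of_nonneg (by positivity)] at hV
  have hVV : V * (4 - V) = (2 * (√(a ^ 2 - 4) / a)) ^ 2 := by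
    rw [hV, mul_pow, div_pow, hs2]
    field_simp
    ring
  rw [hVV, Real.sqrt_sq (by positivity), hhat0]
  simp_rw [hnormψ]
  rw [intervalIntegral.integral_const_mul, hI1, mul_pow, inv_pow, Real.sq_sqrt hpi.le]
  rw [hI1] at hI2
  have hC2 : C ^ 2 * (a * (2 * π)) = (a ^ 2 - 4) * √(a ^ 2 - 4) := by
    rw [← mul_div_assoc, eq_div_iff hs0.ne'] at hI2
    linear_combination (-C ^ 2) * hI2 + (a ^ 2 - 4) * √(a ^ 2 - 4) * hN
  field_simp
  linear_combination hC2 - √(a ^ 2 - 4) * hs2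
end

section
/- Ground-state bound for the discrete-metric Hamiltonian: let V : ℝ → [0,∞) be continuous and 2π-periodic, let t > 0, and let λ ∈ (0,1) satisfy the consistency condition (1/2π)·∫_{-π}^{π} dθ / (1 − λ + t·V(θ)) = 1. Then for every unit vector ψ ∈ L²([-π,π]): (1 − (1/2π)·|∫_{-π}^{π} ψ(θ) dθ|²) + t·∫_{-π}^{π} V(θ)|ψ(θ)|² dθ ≥ λ. That is, λ is the ground state energy of the operator H = 1 − |φ₀⟩⟨φ₀| + t·V(Θ), where φ₀ is the normalized constant function. -/
open MeasureTheory Real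

/-- Weighted Cauchy–Schwarz inequality on an interval, for a continuous positive weight `w`. -/
theorem sq_integral_le_integral_inv_mul_integral_weight {a b : ℝ} (hab : a ≤ b) {w f : ℝ → ℝ}
    (hw : Continuous w) (hpos : ∀ x, 0 < w x) (hf : IntervalIntegrable f volume a b)
    (hf2 : IntervalIntegrable (fun x => f x ^ 2) volume a b)
    (hI : 0 < ∫ x in a..b, 1 / w x) :
    (∫ x in a..b, f x) ^ 2 / (∫ x in a..b, 1 / w x) ≤ ∫ x in a..b, w x * f x ^ 2 := by
  set J := ∫ x in a..b, 1 / w x with hJ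
  set I := ∫ x in a..b, f x with hI'
  set c := I / J with hc
  have hinv : IntervalIntegrable (fun x => 1 / w x) volume a b :=
    (continuous_const.div hw fun x => (hpos x).ne').intervalIntegrable _ _
  have hwf : IntervalIntegrable (fun x => w x * f x ^ 2) volume a b :=
    hf2.continuousOn_mul hw.continuousOn
  have hmono : ∫ x in a..b, (2 * c * f x - c ^ 2 * (1 / w x)) ≤ ∫ x in a..b, w x * f x ^ 2 := by
    refine intervalIntegral.integral_mono_on hab
      ((hf.const_mul _).sub (hinv.const_mul _)) hwf fun x _ => ?_
    have hx := hpos x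
    have hsq : w x * f x ^ 2 - (2 * c * f x - c ^ 2 * (1 / w x)) = w x * (f x - c / w x) ^ 2 := by
      field_simp
      ring
    have : 0 ≤ w x * (f x - c / w x) ^ 2 := by positivity
    linarith
  rw [intervalIntegral.integral_sub (hf.const_mul _) (hinv.const_mul _),
    intervalIntegral.integral_const_mul, intervalIntegral.integral_const_mul, ← hJ, ← hI'] at hmono
  have hval : 2 * c * I - c ^ 2 * J = I ^ 2 / J := by
    rw [hc]
    field_simp
    ring
  linarith

/-- **Ground-state bound for the discrete-metric Hamiltonian** `H = 𝟙 − |φ₀⟩⟨φ₀| + t V(Θ)`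
(eq. (26)–(27) of the paper): if `λ ∈ (0,1)` satisfies the consistency condition
`(1/2π)∫ dθ/(1 − λ + tV(θ)) = 1`, then for every normalized `ψ ∈ L²([-π,π])`,
`(1 − (1/2π)|∫ψ|²) + t∫V|ψ|² ≥ λ`. -/
theorem discrete_metric_ground_state_bound
    (V : ℝ → ℝ) (hVcont : Continuous V) (hVper : Function.Periodic V (2 * π))
    (hVnonneg : ∀ θ, 0 ≤ V θ)
    (t : ℝ) (ht : 0 < t)
    (lam : ℝ) (hlam₀ : 0 < lam) (hlam₁ : lam < 1)
    (hcons : (1 / (2 * π)) * ∫ θ in (-π)..π, 1 / (1 - lam + t * V θ) = 1)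
    (ψ : ℝ → ℂ)
    (hmeas : AEStronglyMeasurable ψ (volume.restrict (Set.Ioc (-π) π)))
    (hnorm : (∫ θ in (-π)..π, ‖ψ θ‖ ^ 2) = 1) :
    (1 - (1 / (2 * π)) * ‖∫ θ in (-π)..π, ψ θ‖ ^ 2)
        + t * ∫ θ in (-π)..π, V θ * ‖ψ θ‖ ^ 2 ≥ lam := by
  have hle : -π ≤ π := by linarith [pi_pos]
  have hf2 : IntervalIntegrable (fun θ => ‖ψ θ‖ ^ 2) volume (-π) π := by
    by_contra h
    rw [intervalIntegral.integral_undef h] at hnorm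
    exact zero_ne_one hnorm
  have hf : IntervalIntegrable (fun θ => ‖ψ θ‖) volume (-π) π := by
    have hdom : IntervalIntegrable (fun θ => 1 + ‖ψ θ‖ ^ 2) volume (-π) π :=
      intervalIntegrable_const.add hf2
    rw [intervalIntegrable_iff_integrableOn_Ioc_of_le hle] at hdom ⊢
    refine Integrable.mono' hdom hmeas.norm (Filter.Eventually.of_forall fun θ => ?_)
    rw [norm_norm]
    nlinarith [sq_nonneg (‖ψ θ‖ - 1)]
  have hJ : ∫ θ in (-π)..π, 1 / (1 - lam + t * V θ) = 2 * π := by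
    have := pi_pos
    field_simp at hcons
    simpa using hcons
  have hpos : ∀ θ, 0 < 1 - lam + t * V θ := fun θ => by
    have := mul_nonneg ht.le (hVnonneg θ)
    linarith
  have hcs := sq_integral_le_integral_inv_mul_integral_weight hle
    (w := fun θ => 1 - lam + t * V θ) (by fun_prop) hpos hf hf2 (by rw [hJ]; positivity)
  have hsplit : ∫ θ in (-π)..π, (1 - lam + t * V θ) * ‖ψ θ‖ ^ 2
      = (1 - lam) + t * ∫ θ in (-π)..π, V θ * ‖ψ θ‖ ^ 2 := by
    simp only [add_mul, mul_assoc]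
    rw [intervalIntegral.integral_add (hf2.const_mul _)
        ((hf2.continuousOn_mul hVcont.continuousOn).const_mul _),
      intervalIntegral.integral_const_mul, intervalIntegral.integral_const_mul, hnorm, mul_one]
  rw [hJ, hsplit] at hcs
  have hnormle : ‖∫ θ in (-π)..π, ψ θ‖ ^ 2 ≤ (∫ θ in (-π)..π, ‖ψ θ‖) ^ 2 := by
    gcongr
    exact intervalIntegral.norm_integral_le_integral_norm hle
  have hscaled : 1 / (2 * π) * ‖∫ θ in (-π)..π, ψ θ‖ ^ 2
      ≤ (∫ θ in (-π)..π, ‖ψ θ‖) ^ 2 / (2 * π) := by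
    rw [one_div_mul_eq_div]
    gcongr
  linarith
end
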